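/- Let R be a commutative ring with 1 + 1 = 0 and let (A, ω_A) and (B, ω_B) be curved associative algebras over R. Let N be an R-module equipped with R-linear maps δ_{1+j} : N ⊗ B^{⊗j} → A ⊗ N for j ≥ 0 forming a DA-bimodule over (A, ω_A) and (B, ω_B), i.e. satisfying: (E1) for every n ≥ 1, all x ∈ N and all b₁, …, b_n ∈ B, ∑_{i+j=n} (μ₂^A ⊗ id_N)( (id_A ⊗ δ_{1+j})( δ_{1+i}(x ⊗ b₁ ⊗ … ⊗ b_i) ⊗ b_{i+1} ⊗ … ⊗ b_n ) ) + ∑_{p=1}^{n−1} δ_n( x ⊗ b₁ ⊗ … ⊗ (b_p · b_{p+1}) ⊗ … ⊗ b_n ) + ∑_{p=0}^{n} δ_{n+2}( x ⊗ b₁ ⊗ … ⊗ b_p ⊗ ω_B ⊗ b_{p+1} ⊗ … ⊗ b_n ) = 0, and (E2) for all x ∈ N, (μ₂^A ⊗ id_N)( (id_A ⊗ δ₁)(δ₁(x)) ) + δ₂(x ⊗ ω_B) = ω_A ⊗ x. Let (X, δ_X) be an ω_B-curved type D-structure over (B, ω_B), and assume either that (X, δ_X) is operationally bounded (δ_X^j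 = 0 for all sufficiently large j) or that N is operationally bounded (δ_{1+j} = 0 for all sufficiently large j). Define δ : N ⊗_R X → A ⊗_R (N ⊗_R X) by δ = ∑_{j=0}^{∞} (δ_{1+j} ⊗ id_X) ∘ (id_N ⊗ δ_X^j). Then (N ⊗_R X, δ) is an ω_A-curved type D-structure over (A, ω_A), i.e. (μ₂^A ⊗ id) ∘ (id_A ⊗ δ) ∘ δ = ω_A ⊗ id_{N⊗X}. -/

import Mathlib

open TensorProduct Finset

noncomputable section

variable (R : Type) [CommRing R]

/-- `TP R B j` is the `j`-fold tensor power `B^{⊗j}` (with `B^{⊗0} = R`),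
nested as `B ⊗ (B ⊗ (⋯ ⊗ R))`. -/
def TP (B : Type) [Ring B] [Algebra R B] : ℕ → ModuleCat R
  | 0 => ModuleCat.of R R
  | j + 1 => ModuleCat.of R (B ⊗[R] ↥(TP B j))

/-- The pure tensor `f 0 ⊗ f 1 ⊗ ⋯ ⊗ f (j-1) ⊗ 1` in `TP R B j`. -/
def purePow (B : Type) [Ring B] [Algebra R B] (f : ℕ → B) : (j : ℕ) → ↥(TP R B j)
  | 0 => (1 : R)
  | j + 1 => f 0 ⊗ₜ[R] purePow B (fun i => f (i + 1)) j

/-- `Tpow R B X j` is `B^{⊗j} ⊗ X`, nested as `B ⊗ (B ⊗ (⋯ ⊗ X))`. -/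
def Tpow (B : Type) [Ring B] [Algebra R B] (X : ModuleCat R) : ℕ → ModuleCat R
  | 0 => X
  | j + 1 => ModuleCat.of R (B ⊗[R] ↥(Tpow B X j))

/-- `id_{B^{⊗j}} ⊗ δ : B^{⊗j} ⊗ X ⟶ B^{⊗(j+1)} ⊗ X`. -/
def extendD (B : Type) [Ring B] [Algebra R B] (X : ModuleCat R)
    (δ : ↥X →ₗ[R] B ⊗[R] ↥X) : (j : ℕ) → (↥(Tpow R B X j) →ₗ[R] ↥(Tpow R B X (j + 1)))
  | 0 => δ
  | j + 1 => LinearMap.lTensor B (extendD B X δ j)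

/-- The iterate `δ^j : X ⟶ B^{⊗j} ⊗ X` of a type-`D` structure map `δ`. -/
def iter (B : Type) [Ring B] [Algebra R B] (X : ModuleCat R)
    (δ : ↥X →ₗ[R] B ⊗[R] ↥X) : (j : ℕ) → (↥X →ₗ[R] ↥(Tpow R B X j))
  | 0 => LinearMap.id
  | j + 1 => (extendD R B X δ j) ∘ₗ (iter B X δ j)

/-- The canonical rearrangement `N ⊗ (B^{⊗j} ⊗ X) ≅ (N ⊗ B^{⊗j}) ⊗ X`. -/
def rearr (B : Type) [Ring B] [Algebra R B] (X : ModuleCat R) :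
    (j : ℕ) → (N : ModuleCat R) →
      ((↥N ⊗[R] ↥(Tpow R B X j)) ≃ₗ[R] ((↥N ⊗[R] ↥(TP R B j)) ⊗[R] ↥X))
  | 0, N => TensorProduct.congr (TensorProduct.rid R ↥N).symm (LinearEquiv.refl R ↥X)
  | j + 1, N =>
      (TensorProduct.assoc R ↥N B ↥(Tpow R B X j)).symm.trans
        ((rearr B X j (ModuleCat.of R (↥N ⊗[R] B))).trans
          (TensorProduct.congr (TensorProduct.assoc R ↥N B ↥(TP R B j))
            (LinearEquiv.refl R ↥X)))

/-- The structure equations of a (curved) `DA`-bimodule over curved associative algebras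
`(A, ωA)` and `(B, ωB)`:  here `d j` is the structure map
`δ_{1+j} : N ⊗ B^{⊗j} → A ⊗ N`, and the two conditions are exactly (E1) and (E2):

(E1) for every `n ≥ 1`, all `x ∈ N` and all `b₁, …, b_n ∈ B`,
`∑_{i+j=n} (μ₂^A ⊗ id_N)((id_A ⊗ δ_{1+j})(δ_{1+i}(x ⊗ b₁ ⊗ ⋯ ⊗ b_i) ⊗ b_{i+1} ⊗ ⋯ ⊗ b_n))
 + ∑_{p=1}^{n-1} δ_n(x ⊗ b₁ ⊗ ⋯ ⊗ (b_p b_{p+1}) ⊗ ⋯ ⊗ b_n)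
 + ∑_{p=0}^{n} δ_{n+2}(x ⊗ b₁ ⊗ ⋯ ⊗ b_p ⊗ ωB ⊗ b_{p+1} ⊗ ⋯ ⊗ b_n) = 0`;

(E2) for all `x ∈ N`,
`(μ₂^A ⊗ id_N)((id_A ⊗ δ₁)(δ₁ x)) + δ₂(x ⊗ ωB) = ωA ⊗ x`. -/
def IsDABimodule
    (A : Type) [Ring A] [Algebra R A] (ωA : A)
    (B : Type) [Ring B] [Algebra R B] (ωB : B)
    (N : ModuleCat R)
    (d : (j : ℕ) → ((↥N ⊗[R] ↥(TP R B j)) →ₗ[R] (A ⊗[R] ↥N))) : Prop :=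
  (∀ n : ℕ, 1 ≤ n → ∀ (x : ↥N) (b : ℕ → B),
    (∑ i ∈ Finset.range (n + 1),
        ((TensorProduct.map (LinearMap.mul' R A) (LinearMap.id : ↥N →ₗ[R] ↥N)) ∘ₗ
          (TensorProduct.assoc R A A ↥N).symm.toLinearMap ∘ₗ
          (LinearMap.lTensor A ((d (n - i)) ∘ₗ
            ((TensorProduct.mk R ↥N ↥(TP R B (n - i))).flip
              (purePow R B (fun t => b (t + i)) (n - i))))))
          (d i (x ⊗ₜ[R] purePow R B b i)))
      + (∑ q ∈ Finset.range (n - 1),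
          d (n - 1) (x ⊗ₜ[R] purePow R B
            (fun t => if t < q then b t else if t = q then b q * b (q + 1) else b (t + 1))
            (n - 1)))
      + (∑ p ∈ Finset.range (n + 1),
          d (n + 1) (x ⊗ₜ[R] purePow R B
            (fun t => if t < p then b t else if t = p then ωB else b (t - 1)) (n + 1)))
      = 0)
  ∧ (∀ x : ↥N,
      ((TensorProduct.map (LinearMap.mul' R A) (LinearMap.id : ↥N →ₗ[R] ↥N)) ∘ₗ
          (TensorProduct.assoc R A A ↥N).symm.toLinearMap ∘ₗ
          (LinearMap.lTensor A ((d 0) ∘ₗ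
            ((TensorProduct.mk R ↥N ↥(TP R B 0)).flip (purePow R B (fun _ => ωB) 0)))))
        (d 0 (x ⊗ₜ[R] purePow R B (fun _ => ωB) 0))
      + d 1 (x ⊗ₜ[R] purePow R B (fun _ => ωB) 1)
      = ωA ⊗ₜ[R] x)

section Helpers

variable {R}
variable {A : Type} [Ring A] [Algebra R A] {B : Type} [Ring B] [Algebra R B]

/-- The pure tensor `b 0 ⊗ ⋯ ⊗ b (j-1) ⊗ x`. -/
def pureT (X : ModuleCat R) (b : ℕ → B) (x : X) : (j : ℕ) → ↥(Tpow R B X j)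
  | 0 => x
  | j + 1 => b 0 ⊗ₜ[R] pureT X (fun i => b (i + 1)) x j

theorem tpow_ext (X : ModuleCat R) {P : Type*} [AddCommGroup P] [Module R P] (j : ℕ)
    (f g : ↥(Tpow R B X j) →ₗ[R] P)
    (h : ∀ (b : ℕ → B) (x : X), f (pureT X b x j) = g (pureT X b x j)) : f = g := by
  induction j generalizing P with
  | zero => exact LinearMap.ext fun x => h (fun _ => 0) x
  | succ j ih =>
    refine TensorProduct.ext (?_ : _ = _)
    refine LinearMap.ext fun c => ?_
    refine ih _ _ fun b x => ?_
    exact h (fun t => Nat.casesOn t c b) x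

theorem ntpow_ext (N X : ModuleCat R) {P : Type*} [AddCommGroup P] [Module R P] (j : ℕ)
    (f g : (↥N ⊗[R] ↥(Tpow R B X j)) →ₗ[R] P)
    (h : ∀ (y : N) (b : ℕ → B) (x : X),
      f (y ⊗ₜ[R] pureT X b x j) = g (y ⊗ₜ[R] pureT X b x j)) : f = g := by
  refine TensorProduct.ext (LinearMap.ext fun y => ?_)
  exact tpow_ext X j _ _ fun b x => h y b x

theorem rearr_pure (X : ModuleCat R) (j : ℕ) (N : ModuleCat R) (y : N) (b : ℕ → B) (x : X) :
    rearr R B X j N (y ⊗ₜ[R] pureT X b x j) = (y ⊗ₜ[R] purePow R B b j) ⊗ₜ[R] x := by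
  induction j generalizing N b with
  | zero => rfl
  | succ j ih =>
    change (TensorProduct.congr (TensorProduct.assoc R ↥N B ↥(TP R B j))
            (LinearEquiv.refl R ↥X)) (rearr R B X j (ModuleCat.of R (↥N ⊗[R] B))
              ((y ⊗ₜ[R] b 0) ⊗ₜ[R] pureT X (fun i => b (i + 1)) x j)) = _
    rw [ih (ModuleCat.of R (↥N ⊗[R] B)) (y ⊗ₜ[R] b 0)]
    rfl

/-- `(δ_{1+j} ⊗ id) ` on `N ⊗ (B^j ⊗ X)`. -/
def eMap (N X : ModuleCat R) (j : ℕ) (dj : (↥N ⊗[R] ↥(TP R B j)) →ₗ[R] (A ⊗[R] ↥N)) :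
    (↥N ⊗[R] ↥(Tpow R B X j)) →ₗ[R] A ⊗[R] (↥N ⊗[R] ↥X) :=
  (TensorProduct.assoc R A ↥N ↥X).toLinearMap ∘ₗ
        (TensorProduct.map dj (LinearMap.id : ↥X →ₗ[R] ↥X)) ∘ₗ
        (rearr R B X j N).toLinearMap

theorem eMap_pure (N X : ModuleCat R) (j : ℕ)
    (dj : (↥N ⊗[R] ↥(TP R B j)) →ₗ[R] (A ⊗[R] ↥N)) (y : N) (b : ℕ → B) (x : X) :
    eMap N X j dj (y ⊗ₜ[R] pureT X b x j)
      = TensorProduct.assoc R A N X (dj (y ⊗ₜ[R] purePow R B b j) ⊗ₜ[R] x) := by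
  simp only [eMap, LinearMap.comp_apply, LinearEquiv.coe_coe]
  rw [rearr_pure]
  rfl

/-- Functoriality of `Tpow`. -/
def mapT {X Y : ModuleCat R} (f : X →ₗ[R] Y) :
    (j : ℕ) → (↥(Tpow R B X j) →ₗ[R] ↥(Tpow R B Y j))
  | 0 => f
  | j + 1 => LinearMap.lTensor B (mapT f j)

theorem mapT_pure {X Y : ModuleCat R} (f : X →ₗ[R] Y) (j : ℕ) (b : ℕ → B) (x : X) :
    mapT f j (pureT X b x j) = pureT Y b (f x) j := by
  induction j generalizing b with
  | zero => rfl
  | succ j ih =>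
    change b 0 ⊗ₜ[R] mapT f j (pureT X (fun i => b (i + 1)) x j) = _
    rw [ih]; rfl

theorem eMap_nat (N : ModuleCat R) {X Y : ModuleCat R} (f : X →ₗ[R] Y) (j : ℕ)
    (dj : (↥N ⊗[R] ↥(TP R B j)) →ₗ[R] (A ⊗[R] ↥N)) :
    eMap N Y j dj ∘ₗ LinearMap.lTensor N (mapT f j)
      = LinearMap.lTensor A (LinearMap.lTensor N f) ∘ₗ eMap N X j dj := by
  refine ntpow_ext N X j _ _ fun y b x => ?_
  simp only [LinearMap.comp_apply, LinearMap.lTensor_tmul, mapT_pure, eMap_pure]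
  generalize dj (y ⊗ₜ[R] purePow R B b j) = z
  induction z using TensorProduct.induction_on with
  | zero => simp
  | tmul a n => simp
  | add u v hu hv => simp only [TensorProduct.add_tmul, map_add, hu, hv]

/-- Splitting `B^{j+i} ⊗ X = B^i ⊗ (B^j ⊗ X)`. -/
def splitT (X : ModuleCat R) (j : ℕ) :
    (i : ℕ) → (↥(Tpow R B X (j + i)) →ₗ[R] ↥(Tpow R B (Tpow R B X j) i))
  | 0 => LinearMap.id
  | i + 1 => LinearMap.lTensor B (splitT X j i)

theorem splitT_pure (X : ModuleCat R) (j i : ℕ) (b : ℕ → B) (x : X) :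
    splitT X j i (pureT X b x (j + i))
      = pureT (Tpow R B X j) b (pureT X (fun t => b (t + i)) x j) i := by
  induction i generalizing b with
  | zero => rfl
  | succ i ih =>
    change b 0 ⊗ₜ[R] splitT X j i (pureT X (fun i => b (i + 1)) x (j + i)) = _
    rw [ih (fun i => b (i + 1))]; rfl

theorem sum_comp_aux {P Q S : Type*} [AddCommGroup P] [Module R P] [AddCommGroup Q] [Module R Q]
    [AddCommGroup S] [Module R S] (s : Finset ℕ) (f : ℕ → Q →ₗ[R] S) (g : P →ₗ[R] Q) :
    (∑ i ∈ s, f i) ∘ₗ g = ∑ i ∈ s, f i ∘ₗ g := by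
  ext x; simp

theorem comp_sum_aux {P Q S : Type*} [AddCommGroup P] [Module R P] [AddCommGroup Q] [Module R Q]
    [AddCommGroup S] [Module R S] (s : Finset ℕ) (f : ℕ → P →ₗ[R] Q) (g : Q →ₗ[R] S) :
    g ∘ₗ (∑ i ∈ s, f i) = ∑ i ∈ s, g ∘ₗ f i := by
  ext x; simp

theorem iter_succ' (X : ModuleCat R) (δ : ↥X →ₗ[R] B ⊗[R] ↥X) (j : ℕ) :
    iter R B X δ (j + 1) = (LinearMap.lTensor B (iter R B X δ j) ∘ₗ δ : ↥X →ₗ[R] B ⊗[R] _) := by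
  induction j with
  | zero => exact LinearMap.ext fun x => (LinearMap.lTensor_id_apply B X (δ x)).symm
  | succ j ih =>
    change extendD R B X δ (j + 1) ∘ₗ iter R B X δ (j + 1) = _
    conv_lhs => rw [ih]
    change LinearMap.lTensor B (extendD R B X δ j) ∘ₗ (LinearMap.lTensor B (iter R B X δ j) ∘ₗ δ)
      = LinearMap.lTensor B (extendD R B X δ j ∘ₗ iter R B X δ j) ∘ₗ δ
    rw [LinearMap.lTensor_comp, LinearMap.comp_assoc]

theorem splitT_iter (X : ModuleCat R) (δ : ↥X →ₗ[R] B ⊗[R] ↥X) (j i : ℕ) :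
    splitT X j i ∘ₗ iter R B X δ (j + i) = mapT (iter R B X δ j) i ∘ₗ iter R B X δ i := by
  induction i with
  | zero => rfl
  | succ i ih =>
    rw [iter_succ' X δ i]
    have h := iter_succ' X δ (j + i)
    change splitT X j (i + 1) ∘ₗ iter R B X δ (j + i + 1) = _
    rw [h]
    change LinearMap.lTensor B (splitT X j i) ∘ₗ (LinearMap.lTensor B (iter R B X δ (j + i)) ∘ₗ δ)
      = LinearMap.lTensor B (mapT (iter R B X δ j) i) ∘ₗ
        (LinearMap.lTensor B (iter R B X δ i) ∘ₗ δ)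
    rw [← LinearMap.comp_assoc, ← LinearMap.comp_assoc, ← LinearMap.lTensor_comp,
      ← LinearMap.lTensor_comp, ih]

/-- Multiplying the first two factors. -/
def mulL (A : Type) [Ring A] [Algebra R A] (P : Type*) [AddCommGroup P] [Module R P] :
    A ⊗[R] (A ⊗[R] P) →ₗ[R] A ⊗[R] P :=
  (TensorProduct.map (LinearMap.mul' R A) (LinearMap.id : P →ₗ[R] P)) ∘ₗ
        (TensorProduct.assoc R A A P).symm.toLinearMap

theorem mulL_tmul {P : Type*} [AddCommGroup P] [Module R P] (a b : A) (p : P) :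
    mulL (R := R) A P (a ⊗ₜ (b ⊗ₜ p)) = (a * b) ⊗ₜ p := by
  simp [mulL]

theorem mulL_nat {P Q : Type*} [AddCommGroup P] [Module R P] [AddCommGroup Q] [Module R Q]
    (f : P →ₗ[R] Q) :
    mulL A Q ∘ₗ LinearMap.lTensor A (LinearMap.lTensor A f)
      = LinearMap.lTensor A f ∘ₗ mulL A P := by
  refine TensorProduct.ext (LinearMap.ext fun a => ?_)
  refine TensorProduct.ext (LinearMap.ext fun b => LinearMap.ext fun p => ?_)
  change mulL A Q (a ⊗ₜ (b ⊗ₜ f p)) = LinearMap.lTensor A f (mulL A P (a ⊗ₜ (b ⊗ₜ p)))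
  rw [mulL_tmul, mulL_tmul]; rfl

theorem mulL_assoc (N X : Type*) [AddCommGroup N] [Module R N] [AddCommGroup X] [Module R X]
    (a : A) (w : A ⊗[R] N) (x : X) :
    mulL A (N ⊗[R] X) (a ⊗ₜ TensorProduct.assoc R A N X (w ⊗ₜ x))
      = TensorProduct.assoc R A N X (mulL A N (a ⊗ₜ w) ⊗ₜ x) := by
  induction w using TensorProduct.induction_on with
  | zero => simp
  | tmul b n => simp [mulL_tmul]
  | add u v hu hv => simp only [TensorProduct.add_tmul, TensorProduct.tmul_add, map_add, hu, hv]

theorem exists_F (N X : ModuleCat R) (δ : ↥X →ₗ[R] B ⊗[R] ↥X)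
    (d : (j : ℕ) → ((↥N ⊗[R] ↥(TP R B j)) →ₗ[R] (A ⊗[R] ↥N))) (n i j : ℕ) (h : j + i = n) :
    ∃ F : (↥N ⊗[R] ↥(Tpow R B X n)) →ₗ[R] A ⊗[R] (↥N ⊗[R] ↥X),
      (∀ (y : N) (b : ℕ → B) (x : X), F (y ⊗ₜ[R] pureT X b x n) =
        TensorProduct.assoc R A N X
          (mulL A N (LinearMap.lTensor A ((d j) ∘ₗ
            ((TensorProduct.mk R ↥N ↥(TP R B j)).flip
              (purePow R B (fun t => b (t + i)) j))) (d i (y ⊗ₜ[R] purePow R B b i))) ⊗ₜ[R] x)) ∧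
      F ∘ₗ LinearMap.lTensor N (iter R B X δ n) =
        mulL A _ ∘ₗ LinearMap.lTensor A (eMap N X j (d j) ∘ₗ LinearMap.lTensor N (iter R B X δ j))
          ∘ₗ (eMap N X i (d i) ∘ₗ LinearMap.lTensor N (iter R B X δ i)) := by
  subst h
  refine ⟨mulL A _ ∘ₗ LinearMap.lTensor A (eMap N X j (d j)) ∘ₗ eMap N (Tpow R B X j) i (d i)
    ∘ₗ LinearMap.lTensor N (splitT X j i), ?_, ?_⟩
  · intro y b x
    simp only [LinearMap.comp_apply, LinearMap.lTensor_tmul, splitT_pure, eMap_pure]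
    generalize d i (y ⊗ₜ[R] purePow R B b i) = z
    induction z using TensorProduct.induction_on with
    | zero => simp
    | tmul a n =>
      simp only [TensorProduct.assoc_tmul, LinearMap.lTensor_tmul, eMap_pure, mulL_assoc]
      rfl
    | add u v hu hv => simp only [TensorProduct.add_tmul, map_add, hu, hv]
  · simp only [LinearMap.comp_assoc]
    rw [← LinearMap.lTensor_comp, splitT_iter, LinearMap.lTensor_comp,
      ← LinearMap.comp_assoc _ _ (eMap N (Tpow R B X j) i (d i)), eMap_nat,
      LinearMap.lTensor_comp]
    simp only [LinearMap.comp_assoc]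

/-- Multiply the `q`-th and `q+1`-st algebra factor. -/
def mergeT (X : ModuleCat R) :
    (q n : ℕ) → (↥(Tpow R B X (n + 1)) →ₗ[R] ↥(Tpow R B X n))
  | _, 0 => 0
  | 0, n + 1 => mulL B ↥(Tpow R B X n)
  | q + 1, n + 1 => LinearMap.lTensor B (mergeT X q n)

/-- Insert `ω` in position `q`. -/
def insT (X : ModuleCat R) (ω : B) :
    (q n : ℕ) → (↥(Tpow R B X n) →ₗ[R] ↥(Tpow R B X (n + 1)))
  | 0, n => TensorProduct.mk R B ↥(Tpow R B X n) ω
  | _ + 1, 0 => 0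
  | q + 1, n + 1 => LinearMap.lTensor B (insT X ω q n)

theorem mergeT_pure (X : ModuleCat R) (q n : ℕ) (h : q < n) (b : ℕ → B) (x : X) :
    mergeT X q n (pureT X b x (n + 1)) = pureT X
      (fun t => if t < q then b t else if t = q then b q * b (q + 1) else b (t + 1)) x n := by
  induction n generalizing q b with
  | zero => omega
  | succ n ih =>
    cases q with
    | zero =>
      change mulL B _ (b 0 ⊗ₜ (b 1 ⊗ₜ pureT X (fun i => b (i + 2)) x n)) = _
      rw [mulL_tmul]
      simp [pureT]
    | succ q =>
      change b 0 ⊗ₜ[R] mergeT X q n (pureT X (fun i => b (i + 1)) x (n + 1)) = _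
      rw [ih q (by omega)]
      simp [pureT]

theorem insT_pure (X : ModuleCat R) (ω : B) (q n : ℕ) (h : q < n + 1) (b : ℕ → B) (x : X) :
    insT X ω q n (pureT X b x n) = pureT X
      (fun t => if t < q then b t else if t = q then ω else b (t - 1)) x (n + 1) := by
  induction n generalizing q b with
  | zero =>
    obtain rfl : q = 0 := by omega
    rfl
  | succ n ih =>
    cases q with
    | zero => rfl
    | succ q =>
      change b 0 ⊗ₜ[R] insT X ω q n (pureT X (fun i => b (i + 1)) x n) = _
      rw [ih q (by omega)]
      have : (fun t => if t < q then b (t + 1) else if t = q then ω else b (t - 1 + 1))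
        = fun t => if t + 1 < q + 1 then b (t + 1) else if t + 1 = q + 1 then ω else
          b (t + 1 - 1) := by
        funext t
        rcases lt_trichotomy t q with h | h | h
        · simp [h]
        · simp [h]
        · have : t - 1 + 1 = t := by omega
          simp [this]
      rw [this]
      rfl

theorem mergeT_zero (X : ModuleCat R) (q : ℕ) : mergeT (B := B) X q 0 = 0 := by
  cases q <;> rfl

theorem mergeT_succ_one (X : ModuleCat R) (q : ℕ) : mergeT (B := B) X (q + 1) 1 = 0 := by
  refine tpow_ext X 2 _ _ fun b x => ?_
  change b 0 ⊗ₜ[R] mergeT X q 0 (pureT X (fun i => b (i + 1)) x 1) = 0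
  rw [mergeT_zero, LinearMap.zero_apply]
  exact TensorProduct.tmul_zero _ _

theorem eq_of_two {M : Type*} [AddCommGroup M] (a b : M) (hb : b + b = 0) (h : a + b = 0) :
    a = b := by
  rw [eq_neg_of_add_eq_zero_left h, neg_eq_of_add_eq_zero_left hb]

theorem merge_iter (X : ModuleCat R) (δ : ↥X →ₗ[R] B ⊗[R] ↥X) (ω : B)
    (hδ : mulL B X ∘ₗ LinearMap.lTensor B δ ∘ₗ δ = TensorProduct.mk R B ↥X ω) (q n : ℕ) :
    mergeT X q (n + 1) ∘ₗ iter R B X δ (n + 2) = insT X ω q n ∘ₗ iter R B X δ n := by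
  induction n generalizing q with
  | zero =>
    cases q with
    | zero => exact hδ
    | succ q =>
      have h0 : mergeT (B := B) X (q + 1) 1 = 0 := mergeT_succ_one X q
      have h1 : insT X ω (q + 1) 0 = 0 := rfl
      rw [h0, h1, LinearMap.zero_comp, LinearMap.zero_comp]
  | succ n ih =>
    cases q with
    | zero =>
      rw [iter_succ' X δ (n + 1 + 1), iter_succ' X δ (n + 1)]
      change mulL B _ ∘ₗ (LinearMap.lTensor B
        (LinearMap.lTensor B (iter R B X δ (n + 1)) ∘ₗ δ) ∘ₗ δ) =
        TensorProduct.mk R B _ ω ∘ₗ _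
      rw [LinearMap.lTensor_comp, LinearMap.comp_assoc, ← LinearMap.comp_assoc, mulL_nat,
        LinearMap.comp_assoc, hδ]
      rfl
    | succ q =>
      rw [iter_succ' X δ (n + 1 + 1), iter_succ' X δ n]
      change LinearMap.lTensor B (mergeT X q (n + 1)) ∘ₗ
        (LinearMap.lTensor B (iter R B X δ (n + 2)) ∘ₗ δ) =
        LinearMap.lTensor B (insT X ω q n) ∘ₗ (LinearMap.lTensor B (iter R B X δ n) ∘ₗ δ)
      rw [← LinearMap.comp_assoc, ← LinearMap.comp_assoc, ← LinearMap.lTensor_comp,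
        ← LinearMap.lTensor_comp, ih]

/-- The summand of the box tensor differential. -/
def dBox (N X : ModuleCat R) (δ : ↥X →ₗ[R] B ⊗[R] ↥X)
    (d : (j : ℕ) → ((↥N ⊗[R] ↥(TP R B j)) →ₗ[R] (A ⊗[R] ↥N))) (j : ℕ) :
    (↥N ⊗[R] ↥X) →ₗ[R] A ⊗[R] (↥N ⊗[R] ↥X) :=
  eMap N X j (d j) ∘ₗ LinearMap.lTensor N (iter R B X δ j)

/-- Composite of two summands. -/
def qBox (N X : ModuleCat R) (δ : ↥X →ₗ[R] B ⊗[R] ↥X)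
    (d : (j : ℕ) → ((↥N ⊗[R] ↥(TP R B j)) →ₗ[R] (A ⊗[R] ↥N))) (i j : ℕ) :
    (↥N ⊗[R] ↥X) →ₗ[R] A ⊗[R] (↥N ⊗[R] ↥X) :=
  mulL A _ ∘ₗ LinearMap.lTensor A (dBox N X δ d j) ∘ₗ dBox N X δ d i

/-- The curvature-insertion terms. -/
def wBox (N X : ModuleCat R) (δ : ↥X →ₗ[R] B ⊗[R] ↥X)
    (d : (j : ℕ) → ((↥N ⊗[R] ↥(TP R B j)) →ₗ[R] (A ⊗[R] ↥N))) (ω : B) (n : ℕ) :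
    (↥N ⊗[R] ↥X) →ₗ[R] A ⊗[R] (↥N ⊗[R] ↥X) :=
  ∑ p ∈ Finset.range (n + 1),
    eMap N X (n + 1) (d (n + 1)) ∘ₗ LinearMap.lTensor N (insT X ω p n ∘ₗ iter R B X δ n)

/-- The multiplication terms. -/
def mBox (N X : ModuleCat R) (δ : ↥X →ₗ[R] B ⊗[R] ↥X)
    (d : (j : ℕ) → ((↥N ⊗[R] ↥(TP R B j)) →ₗ[R] (A ⊗[R] ↥N))) (n : ℕ) :
    (↥N ⊗[R] ↥X) →ₗ[R] A ⊗[R] (↥N ⊗[R] ↥X) :=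
  ∑ p ∈ Finset.range n,
    eMap N X n (d n) ∘ₗ LinearMap.lTensor N (mergeT X p n ∘ₗ iter R B X δ (n + 1))

theorem e1_box (N X : ModuleCat R) (δ : ↥X →ₗ[R] B ⊗[R] ↥X)
    (d : (j : ℕ) → ((↥N ⊗[R] ↥(TP R B j)) →ₗ[R] (A ⊗[R] ↥N))) (ωA : A) (ω : B)
    (hN : IsDABimodule R A ωA B ω N d) (n : ℕ) :
    ∑ i ∈ Finset.range (n + 1 + 1), qBox N X δ d i (n + 1 - i) + mBox N X δ d n
      + wBox N X δ d ω (n + 1) = 0 := by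
  have hex : ∀ i, ∃ F : (↥N ⊗[R] ↥(Tpow R B X (n + 1))) →ₗ[R] A ⊗[R] (↥N ⊗[R] ↥X),
      i ∈ Finset.range (n + 1 + 1) → _ ∧ _ := fun i => by
    by_cases h : i ∈ Finset.range (n + 1 + 1)
    · obtain ⟨F, hF⟩ := exists_F N X δ d (n + 1) i (n + 1 - i)
        (by have := Finset.mem_range.1 h; omega)
      exact ⟨F, fun _ => hF⟩
    · exact ⟨0, fun h' => absurd h' h⟩
  choose F hF using hex
  have key : ∑ i ∈ Finset.range (n + 1 + 1), F i
      + ∑ p ∈ Finset.range n, eMap N X n (d n) ∘ₗ LinearMap.lTensor N (mergeT X p n)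
      + ∑ p ∈ Finset.range (n + 1 + 1), eMap N X (n + 1 + 1) (d (n + 1 + 1)) ∘ₗ
          LinearMap.lTensor N (insT X ω p (n + 1)) = 0 := by
    refine ntpow_ext N X (n + 1) _ _ fun y b x => ?_
    have h1 := congrArg (fun z => TensorProduct.assoc R A N X (z ⊗ₜ[R] x))
      (hN.1 (n + 1) (by omega) y b)
    simp only [TensorProduct.add_tmul, map_add, TensorProduct.sum_tmul, map_sum,
      TensorProduct.zero_tmul, map_zero] at h1
    simp only [LinearMap.add_apply, LinearMap.sum_apply, LinearMap.comp_apply,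
      LinearMap.lTensor_tmul, LinearMap.zero_apply]
    refine Eq.trans ?_ h1
    congr 1
    · congr 1
      · exact Finset.sum_congr rfl fun i hi => (hF i hi).1 y b x
      · refine Finset.sum_congr rfl fun p hp => ?_
        rw [mergeT_pure X p n (Finset.mem_range.1 hp), eMap_pure]
        rfl
    · refine Finset.sum_congr rfl fun p hp => ?_
      rw [insT_pure X ω p (n + 1) (Finset.mem_range.1 hp), eMap_pure]
  have key2 := congrArg (fun f => f ∘ₗ LinearMap.lTensor N (iter R B X δ (n + 1))) key
  simp only [LinearMap.add_comp, LinearMap.zero_comp, sum_comp_aux,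
    LinearMap.comp_assoc, ← LinearMap.lTensor_comp] at key2
  rw [← key2, mBox, wBox]
  congr 2
  exact Finset.sum_congr rfl fun i hi => (hF i hi).2.symm

theorem e2_box (N X : ModuleCat R) (δ : ↥X →ₗ[R] B ⊗[R] ↥X)
    (d : (j : ℕ) → ((↥N ⊗[R] ↥(TP R B j)) →ₗ[R] (A ⊗[R] ↥N))) (ωA : A) (ω : B)
    (hN : IsDABimodule R A ωA B ω N d) :
    qBox N X δ d 0 0 + wBox N X δ d ω 0 = TensorProduct.mk R A (↥N ⊗[R] ↥X) ωA := by
  obtain ⟨F, hF, hF2⟩ := exists_F N X δ d 0 0 0 rfl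
  have key : F + eMap N X 1 (d 1) ∘ₗ LinearMap.lTensor N (insT X ω 0 0)
      = TensorProduct.mk R A (↥N ⊗[R] ↥X) ωA := by
    refine ntpow_ext N X 0 _ _ fun y b x => ?_
    have h1 := congrArg (fun z => TensorProduct.assoc R A N X (z ⊗ₜ[R] x)) (hN.2 y)
    simp only [TensorProduct.add_tmul, map_add] at h1
    refine Eq.trans ?_ h1
    rw [LinearMap.add_apply, hF, LinearMap.comp_apply, LinearMap.lTensor_tmul,
      insT_pure X ω 0 0 (by omega), eMap_pure]
    rfl
  have key2 := congrArg (fun f => f ∘ₗ LinearMap.lTensor N (iter R B X δ 0)) key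
  simp only [LinearMap.add_comp, LinearMap.comp_assoc, ← LinearMap.lTensor_comp] at key2
  have h0 : LinearMap.lTensor N (iter R B X δ 0) = LinearMap.id := LinearMap.lTensor_id _ _
  rw [hF2] at key2
  rw [wBox, Finset.sum_range_one]
  refine Eq.trans key2 ?_
  rw [h0]; rfl

end Helpers

/-- **The box tensor product of a `DA`-bimodule and a type `D`-structure is a type
`D`-structure.**
Let `R` be a commutative ring with `1 + 1 = 0` and let `(A, ωA)` and `(B, ωB)` be curved
associative algebras over `R`.  Let `N` be a `DA`-bimodule over `(A, ωA)` and `(B, ωB)`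
with structure maps `δ_{1+j} = d j : N ⊗ B^{⊗j} → A ⊗ N`, and let `(X, δX)` be an
`ωB`-curved type `D`-structure over `(B, ωB)`; assume one of the two is operationally
bounded.  Then `δ = ∑_{j≥0} (δ_{1+j} ⊗ id_X) ∘ (id_N ⊗ δX^j)` makes `N ⊗ X` an
`ωA`-curved type `D`-structure over `(A, ωA)`:
`(μ₂^A ⊗ id) ∘ (id_A ⊗ δ) ∘ δ = ωA ⊗ id_{N ⊗ X}`. -/
theorem boxTensor_DA_with_D_is_D
    (h2 : (1 : R) + 1 = 0)
    (A : Type) [Ring A] [Algebra R A] (ωA : A) (hωA : ∀ a : A, ωA * a = a * ωA)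
    (B : Type) [Ring B] [Algebra R B] (ωB : B) (hωB : ∀ b : B, ωB * b = b * ωB)
    (N : ModuleCat R)
    (d : (j : ℕ) → ((↥N ⊗[R] ↥(TP R B j)) →ₗ[R] (A ⊗[R] ↥N)))
    (hN : IsDABimodule R A ωA B ωB N d)
    (X : ModuleCat R) (δX : ↥X →ₗ[R] B ⊗[R] ↥X)
    (hδX : (TensorProduct.map (LinearMap.mul' R B) (LinearMap.id : ↥X →ₗ[R] ↥X)) ∘ₗ
        (TensorProduct.assoc R B B ↥X).symm.toLinearMap ∘ₗ
        (LinearMap.lTensor B δX) ∘ₗ δX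
      = TensorProduct.mk R B ↥X ωB)
    (hbdd : (∃ J : ℕ, ∀ j : ℕ, J ≤ j → iter R B X δX j = 0)
      ∨ (∃ J : ℕ, ∀ j : ℕ, J ≤ j → d j = 0))
    (δ : (↥N ⊗[R] ↥X) →ₗ[R] (A ⊗[R] (↥N ⊗[R] ↥X)))
    (hδ : δ = ∑ᶠ j : ℕ,
      (TensorProduct.assoc R A ↥N ↥X).toLinearMap ∘ₗ
        (TensorProduct.map (d j) (LinearMap.id : ↥X →ₗ[R] ↥X)) ∘ₗ
        (rearr R B X j N).toLinearMap ∘ₗ (LinearMap.lTensor ↥N (iter R B X δX j))) :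
    (TensorProduct.map (LinearMap.mul' R A)
        (LinearMap.id : (↥N ⊗[R] ↥X) →ₗ[R] (↥N ⊗[R] ↥X))) ∘ₗ
      (TensorProduct.assoc R A A (↥N ⊗[R] ↥X)).symm.toLinearMap ∘ₗ
      (LinearMap.lTensor A δ) ∘ₗ δ
    = TensorProduct.mk R A (↥N ⊗[R] ↥X) ωA := by
  have hw : ∀ n, mBox N X δX d (n + 1) = wBox N X δX d ωB n := by
    intro n
    rw [mBox, wBox]
    refine Finset.sum_congr rfl fun p _ => ?_
    rw [merge_iter X δX ωB hδX]
  have hm0 : mBox N X δX d 0 = 0 := by rw [mBox, Finset.sum_range_zero]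
  have h1 := e1_box N X δX d ωA ωB hN
  have htwo : ∀ f : (↥N ⊗[R] ↥X) →ₗ[R] (A ⊗[R] (↥N ⊗[R] ↥X)), f + f = 0 := by
    intro f
    have : ((1 : R) + 1) • f = 0 := by rw [h2, zero_smul]
    rwa [add_smul, one_smul] at this
  have hS : ∀ K, ∑ n ∈ Finset.range (K + 2),
      ∑ i ∈ Finset.range (n + 1), qBox N X δX d i (n - i)
      = TensorProduct.mk R A (↥N ⊗[R] ↥X) ωA + wBox N X δX d ωB K
        + wBox N X δX d ωB (K + 1) := by
    intro K
    induction K with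
    | zero =>
      have h10 := h1 0
      have h20 := e2_box N X δX d ωA ωB hN
      rw [hm0, add_zero] at h10
      rw [zero_add, Finset.sum_range_succ, Finset.sum_range_one, zero_add, Finset.sum_range_one,
        Nat.sub_zero]
      rw [← h20, add_assoc (qBox N X δX d 0 0), htwo, add_zero]
      congr 1
      exact eq_of_two _ _ (htwo _) h10
    | succ K ih =>
      rw [Finset.sum_range_succ, ih]
      have h11 := h1 (K + 1)
      rw [hw] at h11
      have h12 : ∑ i ∈ Finset.range (K + 2 + 1), qBox N X δX d i (K + 2 - i)
          = wBox N X δX d ωB K + wBox N X δX d ωB (K + 2) := by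
        refine eq_of_two _ _ (htwo _) ?_
        rw [← add_assoc]
        exact h11
      rw [h12]
      have := htwo (wBox N X δX d ωB K)
      calc _ = TensorProduct.mk R A (↥N ⊗[R] ↥X) ωA
            + (wBox N X δX d ωB K + wBox N X δX d ωB K)
            + wBox N X δX d ωB (K + 1) + wBox N X δX d ωB (K + 2) := by abel
        _ = _ := by rw [this, add_zero]
  -- boundedness
  obtain ⟨K, hD, hQ, hW⟩ : ∃ K : ℕ, (∀ j, K ≤ j → dBox N X δX d j = 0) ∧
      (∀ i j, K ≤ i + j → qBox N X δX d i j = 0) ∧ (∀ n, K ≤ n → wBox N X δX d ωB n = 0) := by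
    rcases hbdd with ⟨J, hJ⟩ | ⟨J, hJ⟩
    · refine ⟨J, fun j hj => ?_, fun i j hij => ?_, fun n hn => ?_⟩
      · rw [dBox, hJ j hj, LinearMap.lTensor_zero, LinearMap.comp_zero]
      · obtain ⟨F, -, hF⟩ := exists_F N X δX d (j + i) i j rfl
        refine Eq.trans hF.symm ?_
        rw [hJ (j + i) (by omega), LinearMap.lTensor_zero, LinearMap.comp_zero]
      · rw [wBox]
        refine Finset.sum_eq_zero fun p _ => ?_
        rw [hJ n hn, LinearMap.comp_zero, LinearMap.lTensor_zero, LinearMap.comp_zero]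
    · have he : ∀ j, J ≤ j → eMap N X j (d j) = 0 := by
        intro j hj
        rw [eMap, hJ j hj, TensorProduct.map_zero_left, LinearMap.zero_comp, LinearMap.comp_zero]
      have hd : ∀ j, J ≤ j → dBox N X δX d j = 0 := by
        intro j hj
        rw [dBox, he j hj, LinearMap.zero_comp]
      refine ⟨2 * J, fun j hj => hd j (by omega), fun i j hij => ?_, fun n hn => ?_⟩
      · rcases le_or_gt J i with h | h
        · rw [qBox, hd i h, LinearMap.comp_zero, LinearMap.comp_zero]
        · rw [qBox, hd j (by omega), LinearMap.lTensor_zero, LinearMap.zero_comp,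
            LinearMap.comp_zero]
      · rw [wBox]
        refine Finset.sum_eq_zero fun p _ => ?_
        rw [he (n + 1) (by omega), LinearMap.zero_comp]
  have hδ' : δ = ∑ j ∈ Finset.range (K + 2), dBox N X δX d j := by
    rw [hδ]
    refine finsum_eq_sum_of_support_subset (dBox N X δX d) ?_
    intro j hj
    rw [Finset.coe_range, Set.mem_Iio]
    by_contra hc
    exact hj (hD j (by omega))
  have hsum : mulL A _ ∘ₗ LinearMap.lTensor A δ ∘ₗ δ
      = ∑ i ∈ Finset.range (K + 2), ∑ j ∈ Finset.range (K + 2), qBox N X δX d i j := by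
    have hl : LinearMap.lTensor A δ
        = ∑ j ∈ Finset.range (K + 2), LinearMap.lTensor A (dBox N X δX d j) := by
      rw [hδ']; exact map_sum (LinearMap.lTensorHom A) _ _
    rw [hl]
    conv_lhs => rw [hδ']
    simp only [comp_sum_aux, sum_comp_aux]
    rfl
  have hfin : ∑ i ∈ Finset.range (K + 2), ∑ j ∈ Finset.range (K + 2), qBox N X δX d i j
      = ∑ n ∈ Finset.range (K + 2), ∑ i ∈ Finset.range (n + 1), qBox N X δX d i (n - i) := by
    rw [Finset.sum_sigma', Finset.sum_sigma']
    symm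
    refine Finset.sum_of_injOn (fun s => ⟨s.2, s.1 - s.2⟩) ?_ ?_ ?_ ?_
    · rintro ⟨n, i⟩ h ⟨n', i'⟩ h' heq
      simp only [Finset.coe_sigma, Finset.mem_coe, Set.mem_sigma_iff, Finset.mem_range,
        Sigma.mk.injEq, heq_eq_eq] at h h' heq ⊢
      omega
    · rintro ⟨n, i⟩ h
      simp only [Finset.coe_sigma, Finset.mem_coe, Set.mem_sigma_iff, Finset.mem_range] at h ⊢
      omega
    · rintro ⟨i, j⟩ h hn
      refine hQ i j ?_
      by_contra hc
      refine hn ⟨⟨i + j, i⟩, ?_, ?_⟩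
      · simp only [Finset.coe_sigma, Finset.mem_coe, Set.mem_sigma_iff, Finset.mem_range]
        omega
      · simp
    · rintro ⟨n, i⟩ h
      rfl
  refine Eq.trans hsum ?_
  rw [hfin, hS K, hW K le_rfl, hW (K + 1) (by omega), add_zero, add_zero]

end
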